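/- Size bound on the set B(t): for every ground term t, every u ∈ B(t) satisfies |u| ≤ 2·|t↓_R|, and the cardinality of B(t) is at most |t↓_R|² · 2^{|t↓_R|}. -/

import Mathlib

/-- The signature: pairing, decryption, projections, zero, key generation,
randomized encryption, equality test, if-then-else, booleans, countably many
adversarial symbols, names, plus auxiliary symbols (boxed conditionals, the
freezing symbol, and hole markers) used in some developments. -/
inductive FSym : Type
  | pair | dec | proj1 | proj2 | zero | pk | sk | enc | eq | ite | tt | ff
  | box | freeze
  | adv (i : ℕ)
  | name (n : ℕ)
  | hole (i : ℕ)
  deriving DecidableEq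

/-- Ground terms over the signature. -/
inductive Tm : Type
  | app : FSym → List Tm → Tm

namespace Tm
def pairT (s t : Tm) : Tm := .app .pair [s, t]
def decT (s t : Tm) : Tm := .app .dec [s, t]
def proj1T (s : Tm) : Tm := .app .proj1 [s]
def proj2T (s : Tm) : Tm := .app .proj2 [s]
def zeroT (s : Tm) : Tm := .app .zero [s]
def pkT (s : Tm) : Tm := .app .pk [s]
def skT (s : Tm) : Tm := .app .sk [s]
def encT (m k r : Tm) : Tm := .app .enc [m, k, r]
def eqT (s t : Tm) : Tm := .app .eq [s, t]
def iteT (b s t : Tm) : Tm := .app .ite [b, s, t]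
def trueT : Tm := .app .tt []
def falseT : Tm := .app .ff []
def nameT (n : ℕ) : Tm := .app (.name n) []
def holeT (i : ℕ) : Tm := .app (.hole i) []
def boxT (a b c : Tm) : Tm := .app .box [a, b, c]
def freezeT (b : Tm) : Tm := .app .freeze [b]
end Tm

open Tm

/-- A term is if-free if it contains no occurrence of if-then-else. -/
inductive IfFree : Tm → Prop
  | app {f : FSym} {ts : List Tm} (hf : f ≠ FSym.ite) (h : ∀ t ∈ ts, IfFree t) :
      IfFree (Tm.app f ts)

def IsIte (t : Tm) : Prop := ∃ b x y, t = iteT b x y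

/-- The computation equations R1, oriented left-to-right. -/
inductive R1 : Tm → Tm → Prop
  | proj1 (x y : Tm) : R1 (proj1T (pairT x y)) x
  | proj2 (x y : Tm) : R1 (proj2T (pairT x y)) y
  | decEnc (x y z : Tm) : R1 (decT (encT x (pkT y) z) (skT y)) x
  | eqRefl (x : Tm) : R1 (eqT x x) trueT

/-- The if-homomorphism equations R2, oriented left-to-right. -/
inductive R2 : Tm → Tm → Prop
  | homo (f : FSym) (hf : f ≠ FSym.ite) (l r : List Tm) (b x y : Tm) :
      R2 (.app f (l ++ iteT b x y :: r))
         (iteT b (.app f (l ++ x :: r)) (.app f (l ++ y :: r)))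
  | guard (b a c x y : Tm) :
      R2 (iteT (iteT b a c) x y) (iteT b (iteT a x y) (iteT c x y))

/-- The if-simplification equations R3, oriented left-to-right. -/
inductive R3 : Tm → Tm → Prop
  | same (b x : Tm) : R3 (iteT b x x) x
  | ifTrue (x y : Tm) : R3 (iteT trueT x y) x
  | ifFalse (x y : Tm) : R3 (iteT falseT x y) y
  | absorbThen (b x y z : Tm) : R3 (iteT b (iteT b x y) z) (iteT b x z)
  | absorbElse (b x y z : Tm) : R3 (iteT b x (iteT b y z)) (iteT b x z)

/-- The if-permutation equations R4 (as unoriented equations,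
read here left-to-right; the oriented system restricts them). -/
inductive R4 : Tm → Tm → Prop
  | permThen (b a x y z : Tm) :
      R4 (iteT b (iteT a x y) z) (iteT a (iteT b x z) (iteT b y z))
  | permElse (b a x y z : Tm) :
      R4 (iteT b x (iteT a y z)) (iteT a (iteT b x y) (iteT b x z))

/-- Closure of a root rewrite relation under contexts (one rewrite step). -/
inductive Step (root : Tm → Tm → Prop) : Tm → Tm → Prop
  | root {s t : Tm} : root s t → Step root s t
  | ctx {f : FSym} {l r : List Tm} {s t : Tm} :
      Step root s t → Step root (.app f (l ++ s :: r)) (.app f (l ++ t :: r))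

def RRoot (s t : Tm) : Prop := R1 s t ∨ R2 s t ∨ R3 s t ∨ R4 s t

/-- The congruence =_R generated by the equations R = R1 ∪ R2 ∪ R3 ∪ R4. -/
inductive REq : Tm → Tm → Prop
  | step {s t : Tm} : Step RRoot s t → REq s t
  | refl (t : Tm) : REq t t
  | symm {s t : Tm} : REq s t → REq t s
  | trans {s t u : Tm} : REq s t → REq t u → REq s u

/-- Irreducible for the computation rules R1.  (For an if-free term this is
exactly being in R-normal form, since all other rules of R involve an
if-then-else.) -/
def R1Nf (t : Tm) : Prop := ∀ s, ¬ Step R1 t s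

/-- If-free conditionals in R-normal form. -/
def NfIfFree (t : Tm) : Prop := IfFree t ∧ R1Nf t

mutual
  /-- The lexicographic path ordering induced by the precedence `prec`
  (`prec f g` meaning f ≻ g): `LPO prec s t` means s ≻ t. -/
  inductive LPO (prec : FSym → FSym → Prop) : Tm → Tm → Prop
    | subGt {f : FSym} {ss : List Tm} {t : Tm} (s : Tm) (hs : s ∈ ss)
        (h : LPO prec s t) : LPO prec (.app f ss) t
    | subEq {f : FSym} {ss : List Tm} {t : Tm} (hs : t ∈ ss) :
        LPO prec (.app f ss) t
    | lex {f : FSym} {ss ts : List Tm}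
        (h1 : ∀ t ∈ ts, LPO prec (.app f ss) t)
        (h2 : LPOLex prec ss ts) : LPO prec (.app f ss) (.app f ts)
    | prec_ {f g : FSym} {ss ts : List Tm} (hfg : prec f g)
        (h : ∀ t ∈ ts, LPO prec (.app f ss) t) : LPO prec (.app f ss) (.app g ts)

  /-- Lexicographic extension of the LPO to lists. -/
  inductive LPOLex (prec : FSym → FSym → Prop) : List Tm → List Tm → Prop
    | head {s t : Tm} {ss ts : List Tm} (h : LPO prec s t) :
        LPOLex prec (s :: ss) (t :: ts)
    | tail {s : Tm} {ss ts : List Tm} (h : LPOLex prec ss ts) :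
        LPOLex prec (s :: ss) (s :: ts)
end

/-- `prec` is a total precedence on function symbols with if-then-else minimal. -/
def PrecOK (prec : FSym → FSym → Prop) : Prop :=
  (∀ f g h, prec f g → prec g h → prec f h) ∧
  (∀ f, ¬ prec f f) ∧
  (∀ f g, f ≠ g → prec f g ∨ prec g f) ∧
  (∀ f, f ≠ FSym.ite → prec f FSym.ite)

/-- `su` is a total (strict) order on if-free conditionals in R-normal form. -/
def SuOK (su : Tm → Tm → Prop) : Prop :=
  (∀ a b c, su a b → su b c → su a c) ∧
  (∀ a, ¬ su a a) ∧
  (∀ a b, NfIfFree a → NfIfFree b → a ≠ b → su a b ∨ su b a)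

/-- The ordering ≻_c on conditionals, combining the user-chosen total order
`su` on if-free R-normal conditionals with the LPO. -/
def CondGt (prec : FSym → FSym → Prop) (su : Tm → Tm → Prop) (b a : Tm) : Prop :=
  (NfIfFree a ∧ NfIfFree b ∧ su b a) ∨
  (¬ NfIfFree a ∧ ¬ NfIfFree b ∧ LPO prec b a) ∨
  (NfIfFree a ∧ ¬ NfIfFree b)

/-- Root steps of the oriented rewrite system R^{≻u}: R1, R2, R3 oriented
left-to-right, and the ground instances of R4 oriented by ≻_c. -/
inductive ORoot (prec : FSym → FSym → Prop) (su : Tm → Tm → Prop) : Tm → Tm → Prop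
  | r1 {s t : Tm} : R1 s t → ORoot prec su s t
  | r2 {s t : Tm} : R2 s t → ORoot prec su s t
  | r3 {s t : Tm} : R3 s t → ORoot prec su s t
  | permThen {b a x y z : Tm} (h : CondGt prec su b a) :
      ORoot prec su (iteT b (iteT a x y) z) (iteT a (iteT b x z) (iteT b y z))
  | permElse {b a x y z : Tm} (h : CondGt prec su b a) :
      ORoot prec su (iteT b x (iteT a y z)) (iteT a (iteT b x y) (iteT b x z))

/-- One rewrite step of the oriented system →_{R^{≻u}}. -/
def RW (prec : FSym → FSym → Prop) (su : Tm → Tm → Prop) : Tm → Tm → Prop :=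
  Step (ORoot prec su)

/-- `w` is the normal form of `t` for the oriented system. -/
def IsNfOf (prec : FSym → FSym → Prop) (su : Tm → Tm → Prop) (t w : Tm) : Prop :=
  Relation.ReflTransGen (RW prec su) t w ∧ ∀ s, ¬ RW prec su w s

/-- `Leaf t u`: `u` is a leaf of the R-normal form term `t`
(seen through the grammar t ::= u | if b then t₁ else t₂). -/
inductive Leaf : Tm → Tm → Prop
  | base {t : Tm} (h : ¬ IsIte t) : Leaf t t
  | left {b x y u : Tm} (h : Leaf x u) : Leaf (iteT b x y) u
  | right {b x y u : Tm} (h : Leaf y u) : Leaf (iteT b x y) u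

/-- `Cond t c`: `c` is one of the guard conditionals of `t`. -/
inductive Cond : Tm → Tm → Prop
  | here {b x y : Tm} : Cond (iteT b x y) b
  | left {b x y c : Tm} (h : Cond x c) : Cond (iteT b x y) c
  | right {b x y c : Tm} (h : Cond y c) : Cond (iteT b x y) c

/-- `TSub t s` : `s` is a subterm of `t`. -/
inductive TSub : Tm → Tm → Prop
  | refl (t : Tm) : TSub t t
  | app {f : FSym} {ts : List Tm} {u s : Tm} (h : u ∈ ts) (hs : TSub u s) :
      TSub (.app f ts) s

mutual
  /-- The size (number of positions) of a term. -/
  def tsize : Tm → ℕ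
    | .app _ ts => 1 + tsizeL ts
  def tsizeL : List Tm → ℕ
    | [] => 0
    | t :: ts => tsize t + tsizeL ts
end

/-- `Zeta K u v` : v ∈ ζ_K(u), the set of terms obtained from u by removing
`zero`s in front of decryptions under keys of K, non-deterministically
stopping at some encryptions under keys of K. -/
inductive Zeta (K : Finset ℕ) : Tm → Tm → Prop
  | unzero {w v : Tm} {k : ℕ} (hk : k ∈ K) (h : Zeta K w v) :
      Zeta K (zeroT (decT w (skT (nameT k)))) (decT v (skT (nameT k)))
  | encKeep {m r : Tm} {k : ℕ} (hk : k ∈ K) :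
      Zeta K (encT m (pkT (nameT k)) r) (encT m (pkT (nameT k)) r)
  | encRec {m v r : Tm} {k : ℕ} (hk : k ∈ K) (h : Zeta K m v) :
      Zeta K (encT m (pkT (nameT k)) r) (encT v (pkT (nameT k)) r)
  | app {f : FSym} {ts us : List Tm}
      (h1 : ∀ w (k : ℕ), k ∈ K → Tm.app f ts ≠ zeroT (decT w (skT (nameT k))))
      (h2 : ∀ m r (k : ℕ), k ∈ K → Tm.app f ts ≠ encT m (pkT (nameT k)) r)
      (hlen : ts.length = us.length)
      (h : ∀ i : Fin ts.length, Zeta K (ts.get i) (us.get (Fin.cast hlen i))) :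
      Zeta K (.app f ts) (.app f us)

/-- guards_K(S) = { eq(s, α) : dec(s, sk(n)) ∈ S, α an encryption under pk(n)
occurring in s, sk(n) ∈ K }. -/
def guardsK (K : Finset ℕ) (S : Set Tm) : Set Tm :=
  {g | ∃ (s m r : Tm) (k : ℕ), k ∈ K ∧ decT s (skT (nameT k)) ∈ S ∧
        TSub s (encT m (pkT (nameT k)) r) ∧
        g = eqT s (encT m (pkT (nameT k)) r)}

/-- The set B(t), computed from the R-normal form `tn` of `t`:
B(t) = ⋃_{K ⊆ S_key(t)} ⋃_{u ∈ st(leaves(t↓)) ∪ st(conds(t↓))}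
        ζ_K(u) ∪ guards_K(ζ_K(u)). -/
def BSet (tn : Tm) : Set Tm :=
  {u | ∃ K : Finset ℕ,
        (∀ k ∈ K, TSub tn (skT (nameT k))) ∧
        ∃ w, ((∃ l, Leaf tn l ∧ TSub l w) ∨ (∃ c, Cond tn c ∧ TSub c w)) ∧
          (Zeta K w u ∨ u ∈ guardsK K {z | Zeta K w z})}

mutual
  /-- The number of positions of a term whose function symbol satisfies `p`. -/
  def symCount (p : FSym → Bool) : Tm → ℕ
    | .app f ts => (p f).toNat + symCountL p ts
  def symCountL (p : FSym → Bool) : List Tm → ℕ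
    | [] => 0
    | t :: ts => symCount p t + symCountL p ts
end

mutual
  theorem symCount_true : ∀ t, symCount (fun _ => true) t = tsize t
    | .app f ts => by simp [symCount, tsize, symCountL_true ts]
  theorem symCountL_true : ∀ ts, symCountL (fun _ => true) ts = tsizeL ts
    | [] => rfl
    | t :: ts => by simp [symCountL, tsizeL, symCount_true t, symCountL_true ts]
end

mutual
  theorem symCount_add_le {p q : FSym → Bool} (h : ∀ f, (p f).toNat + (q f).toNat ≤ 1) :
      ∀ t, symCount p t + symCount q t ≤ tsize t
    | .app f ts => by
        have := h f
        have := symCountL_add_le h ts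
        simp only [symCount, tsize]
        omega
  theorem symCountL_add_le {p q : FSym → Bool} (h : ∀ f, (p f).toNat + (q f).toNat ≤ 1) :
      ∀ ts, symCountL p ts + symCountL q ts ≤ tsizeL ts
    | [] => le_rfl
    | t :: ts => by
        have := symCount_add_le h t
        have := symCountL_add_le h ts
        simp only [symCountL, tsizeL]
        omega
end

theorem symCount_le_symCountL (p : FSym → Bool) {t : Tm} :
    ∀ {ts : List Tm}, t ∈ ts → symCount p t ≤ symCountL p ts
  | a :: ts, h => by
      rcases List.mem_cons.1 h with rfl | h
      · simp [symCountL]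
      · have := symCount_le_symCountL p h
        simp only [symCountL]
        omega

theorem TSub.symCount_le (p : FSym → Bool) {t s : Tm} (h : TSub t s) :
    symCount p s ≤ symCount p t := by
  induction h with
  | refl => exact le_rfl
  | app hu _ ih =>
      have := symCount_le_symCountL p hu
      simp only [symCount]
      omega

theorem TSub.tsize_le {t s : Tm} (h : TSub t s) : tsize s ≤ tsize t := by
  simpa only [symCount_true] using h.symCount_le (fun _ => true)

theorem tsize_lt_of_mem {f : FSym} {ts : List Tm} {t : Tm} (h : t ∈ ts) :
    tsize t < tsize (.app f ts) := by
  have := symCount_le_symCountL (fun _ => true) h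
  simp only [symCount_true, symCountL_true] at this
  simp only [tsize]
  omega

theorem tsize_pos (t : Tm) : 0 < tsize t := by
  cases t
  simp only [tsize]
  omega

theorem TSub.trans {a b c : Tm} (h : TSub a b) (h' : TSub b c) : TSub a c := by
  induction h with
  | refl => exact h'
  | app hu _ ih => exact .app hu (ih h')

theorem Leaf.tSub {t l : Tm} (h : Leaf t l) : TSub t l := by
  induction h with
  | base => exact .refl _
  | left _ ih => exact .app (by simp) ih
  | right _ ih => exact .app (by simp) ih

theorem Cond.tSub {t c : Tm} (h : Cond t c) : TSub t c := by
  induction h with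
  | here => exact .app (List.mem_cons_self) (.refl _)
  | left _ ih => exact .app (by simp) ih
  | right _ ih => exact .app (by simp) ih

noncomputable instance : DecidableEq Tm := Classical.decEq _

mutual
  /-- The subterms of a term whose root symbol satisfies `p`. -/
  noncomputable def subterms (p : FSym → Bool) : Tm → Finset Tm
    | .app f ts => (if p f then {.app f ts} else ∅) ∪ subtermsL p ts
  noncomputable def subtermsL (p : FSym → Bool) : List Tm → Finset Tm
    | [] => ∅
    | t :: ts => subterms p t ∪ subtermsL p ts
end

mutual
  theorem card_subterms_le (p : FSym → Bool) : ∀ t, (subterms p t).card ≤ symCount p t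
    | .app f ts => by
        have := card_subtermsL_le p ts
        simp only [subterms, symCount]
        refine (Finset.card_union_le _ _).trans (Nat.add_le_add ?_ this)
        cases p f <;> simp
  theorem card_subtermsL_le (p : FSym → Bool) : ∀ ts, (subtermsL p ts).card ≤ symCountL p ts
    | [] => by simp [subtermsL]
    | t :: ts => by
        simp only [subtermsL, symCountL]
        exact (Finset.card_union_le _ _).trans
          (Nat.add_le_add (card_subterms_le p t) (card_subtermsL_le p ts))
end

theorem subterms_subset_subtermsL (p : FSym → Bool) {t : Tm} :
    ∀ {ts : List Tm}, t ∈ ts → subterms p t ⊆ subtermsL p ts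
  | a :: ts, h => by
      rcases List.mem_cons.1 h with rfl | h
      · simp [subtermsL]
      · exact (subterms_subset_subtermsL p h).trans (by simp [subtermsL])

theorem TSub.mem_subterms {p : FSym → Bool} {f : FSym} {ts : List Tm} (hp : p f = true)
    {t s : Tm} (h : TSub t s) (hs : s = .app f ts) : s ∈ subterms p t := by
  induction h with
  | refl => subst hs; simp [subterms, hp]
  | app hu _ ih =>
      simp only [subterms, Finset.mem_union]
      exact .inr (subterms_subset_subtermsL p hu (ih hs))

theorem TSub.mem_subterms_true {t s : Tm} (h : TSub t s) : s ∈ subterms (fun _ => true) t := by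
  cases s
  exact h.mem_subterms rfl rfl

theorem card_subterms_true_le (t : Tm) : (subterms (fun _ => true) t).card ≤ tsize t :=
  (card_subterms_le _ t).trans (symCount_true t).le

theorem tsizeL_le_of_forall₂ {ts us : List Tm}
    (h : List.Forall₂ (fun t u => tsize u ≤ tsize t) ts us) : tsizeL us ≤ tsizeL ts := by
  induction h with
  | nil => exact le_rfl
  | cons h _ ih => simp only [tsizeL]; omega

theorem Zeta.tsize_le {K : Finset ℕ} {w v : Tm} (h : Zeta K w v) : tsize v ≤ tsize w := by
  induction h with
  | unzero _ _ ih => simp only [zeroT, decT, tsize, tsizeL]; omega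
  | encKeep => exact le_rfl
  | encRec _ _ ih => simp only [encT, tsize, tsizeL]; omega
  | app _ _ hlen _ ih =>
      have := tsizeL_le_of_forall₂ (List.forall₂_iff_get.2 ⟨hlen, fun i h₁ _ => ih ⟨i, h₁⟩⟩)
      simp only [tsize]
      omega

theorem exists_finset_forall₂ {R : Tm → Tm → Prop} {c : Tm → ℕ} (ts : List Tm)
    (h : ∀ t ∈ ts, ∃ F : Finset Tm, F.card ≤ c t ∧ ∀ v, R t v → v ∈ F) :
    ∃ G : Finset (List Tm), G.card ≤ (ts.map c).prod ∧
      ∀ us, List.Forall₂ R ts us → us ∈ G := by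
  induction ts with
  | nil => exact ⟨{[]}, by simp, by simp⟩
  | cons t ts ih =>
      obtain ⟨F, hF, hRF⟩ := h t (by simp)
      obtain ⟨G, hG, hRG⟩ := ih fun t ht => h t (by simp [ht])
      refine ⟨(F ×ˢ G).image fun x => x.1 :: x.2, ?_, ?_⟩
      · refine Finset.card_image_le.trans ?_
        rw [Finset.card_product, List.map_cons, List.prod_cons]
        exact Nat.mul_le_mul hF hG
      · rintro _ (_ | ⟨h₁, h₂⟩)
        exact Finset.mem_image.2 ⟨(_, _), Finset.mem_product.2 ⟨hRF _ h₁, hRG _ h₂⟩, rfl⟩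

theorem prod_map_two_pow_symCount (p : FSym → Bool) (ts : List Tm) :
    (ts.map fun t => 2 ^ symCount p t).prod = 2 ^ symCountL p ts := by
  induction ts with
  | nil => rfl
  | cons t ts ih => rw [List.map_cons, List.prod_cons, ih, symCountL, pow_add]

theorem exists_finset_zeta (K : Finset ℕ) (w : Tm) :
    ∃ F : Finset Tm, F.card ≤ 2 ^ symCount (· == .enc) w ∧ ∀ v, Zeta K w v → v ∈ F := by
  by_cases h1 : ∃ w' k, k ∈ K ∧ w = zeroT (decT w' (skT (nameT k)))
  · obtain ⟨w', k, hk, rfl⟩ := h1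
    have : tsize w' < tsize (zeroT (decT w' (skT (nameT k)))) := by
      simp only [zeroT, decT, tsize, tsizeL]; omega
    obtain ⟨F, hF, hZ⟩ := exists_finset_zeta K w'
    refine ⟨F.image fun v => decT v (skT (nameT k)), ?_, fun v hv => ?_⟩
    · refine Finset.card_image_le.trans (hF.trans (Nat.pow_le_pow_right two_pos ?_))
      simp only [zeroT, decT, symCount, symCountL]; omega
    · generalize hx : zeroT (decT w' (skT (nameT k))) = x at hv
      cases hv with
      | unzero _ h =>
          simp only [zeroT, decT, skT, nameT, Tm.app.injEq, List.cons.injEq, FSym.name.injEq,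
            true_and, and_true] at hx
          obtain ⟨rfl, rfl⟩ := hx
          exact Finset.mem_image_of_mem _ (hZ _ h)
      | encKeep => simp [zeroT, encT] at hx
      | encRec => simp [zeroT, encT] at hx
      | app h1 => exact absurd hx.symm (h1 _ _ hk)
  by_cases h2 : ∃ m r k, k ∈ K ∧ w = encT m (pkT (nameT k)) r
  · obtain ⟨m, r, k, hk, rfl⟩ := h2
    have : tsize m < tsize (encT m (pkT (nameT k)) r) := by
      simp only [encT, tsize, tsizeL]; omega
    obtain ⟨F, hF, hZ⟩ := exists_finset_zeta K m
    refine ⟨insert (encT m (pkT (nameT k)) r) (F.image fun v => encT v (pkT (nameT k)) r),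
      ?_, fun v hv => ?_⟩
    · have h3 : 2 ^ (1 + symCount (· == .enc) m) ≤
          2 ^ symCount (· == .enc) (encT m (pkT (nameT k)) r) := by
        refine Nat.pow_le_pow_right two_pos ?_
        simp only [encT, symCount, symCountL, beq_self_eq_true, Bool.toNat_true]; omega
      have h4 := Nat.one_le_two_pow (n := symCount (· == .enc) m)
      have h5 := (Finset.card_image_le (s := F) (f := fun v => encT v (pkT (nameT k)) r))
      refine (Finset.card_insert_le _ _).trans ?_
      rw [pow_add] at h3
      omega
    · generalize hx : encT m (pkT (nameT k)) r = x at hv ⊢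
      cases hv with
      | unzero => simp [zeroT, encT] at hx
      | encKeep => exact Finset.mem_insert_self _ _
      | encRec _ h =>
          simp only [encT, pkT, nameT, Tm.app.injEq, List.cons.injEq, FSym.name.injEq,
            true_and, and_true] at hx
          obtain ⟨rfl, rfl, rfl⟩ := hx
          exact Finset.mem_insert_of_mem (Finset.mem_image_of_mem _ (hZ _ h))
      | app _ h2 => exact absurd hx.symm (h2 _ _ _ hk)
  obtain ⟨f, ts⟩ := w
  obtain ⟨G, hG, hZ⟩ := exists_finset_forall₂ (R := Zeta K)
    (c := fun t => 2 ^ symCount (· == .enc) t) ts fun t ht =>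
      have : tsize t < tsize (.app f ts) := tsize_lt_of_mem ht
      exists_finset_zeta K t
  rw [prod_map_two_pow_symCount] at hG
  refine ⟨G.image (.app f), ?_, fun v hv => ?_⟩
  · refine Finset.card_image_le.trans (hG.trans (Nat.pow_le_pow_right two_pos ?_))
    simp only [symCount]; omega
  · generalize hx : Tm.app f ts = x at hv h1 h2
    cases hv with
    | unzero hk => exact absurd ⟨_, _, hk, rfl⟩ h1
    | encKeep hk => exact absurd ⟨_, _, _, hk, rfl⟩ h2
    | encRec hk => exact absurd ⟨_, _, _, hk, rfl⟩ h2
    | app _ _ hlen h =>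
        obtain ⟨rfl, rfl⟩ := Tm.app.inj hx
        exact Finset.mem_image_of_mem _
          (hZ _ (List.forall₂_iff_get.2 ⟨hlen, fun i h₁ _ => h ⟨i, h₁⟩⟩))
termination_by tsize w

theorem tSub_of_leaf_or_cond {t w : Tm}
    (h : (∃ l, Leaf t l ∧ TSub l w) ∨ (∃ c, Cond t c ∧ TSub c w)) : TSub t w := by
  rcases h with ⟨l, hl, h⟩ | ⟨c, hc, h⟩
  exacts [hl.tSub.trans h, hc.tSub.trans h]

/-- A term and the guards it generates are at most as many as its positions. -/
theorem exists_finset_guards (K : Finset ℕ) (z : Tm) :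
    ∃ F : Finset Tm, F.card ≤ tsize z ∧ z ∈ F ∧ ∀ u ∈ guardsK K {z}, u ∈ F := by
  by_cases h : ∃ s k, z = decT s (skT (nameT k))
  · obtain ⟨s, k, rfl⟩ := h
    refine ⟨insert (decT s (skT (nameT k))) ((subterms (fun _ => true) s).image (eqT s)),
      ?_, Finset.mem_insert_self _ _, ?_⟩
    · have h1 := card_subterms_true_le s
      have h2 := Finset.card_image_le (s := subterms (fun _ => true) s) (f := eqT s)
      refine (Finset.card_insert_le _ _).trans ?_
      simp only [decT, tsize, tsizeL]; omega
    · rintro _ ⟨s', m, r, k', -, hs, hsub, rfl⟩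
      simp only [Set.mem_singleton_iff, decT, Tm.app.injEq, List.cons.injEq, true_and] at hs
      obtain ⟨rfl, -⟩ := hs
      exact Finset.mem_insert_of_mem (Finset.mem_image_of_mem _ hsub.mem_subterms_true)
  · refine ⟨{z}, (Finset.card_singleton z).trans_le (tsize_pos z), by simp, ?_⟩
    rintro _ ⟨s, m, r, k, -, hs, -, rfl⟩
    exact absurd ⟨s, k, hs.symm⟩ h

theorem tsize_le_of_mem_guardsK {K : Finset ℕ} {w u : Tm}
    (h : u ∈ guardsK K {z | Zeta K w z}) : tsize u ≤ 2 * tsize w := by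
  obtain ⟨s, m, r, k, -, hz, hsub, rfl⟩ := h
  have h1 := Zeta.tsize_le hz
  have h2 := hsub.tsize_le
  simp only [decT, tsize, tsizeL] at h1
  simp only [eqT, tsize, tsizeL] at h2 ⊢
  omega

theorem exists_finset_keys (t : Tm) :
    ∃ F : Finset ℕ, F.card ≤ symCount (· == .sk) t ∧
      ∀ k, TSub t (skT (nameT k)) → k ∈ F := by
  have hinj : Function.Injective fun k => skT (nameT k) := fun a b h => by
    simpa [skT, nameT] using h
  refine ⟨(subterms (· == .sk) t).preimage (fun k => skT (nameT k)) hinj.injOn, ?_, ?_⟩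
  · refine le_trans ?_ (card_subterms_le _ t)
    exact Finset.card_le_card_of_injOn _ (fun k hk => Finset.mem_preimage.1 hk) hinj.injOn
  · exact fun k hk => Finset.mem_preimage.2 (hk.mem_subterms rfl rfl)

theorem exists_finset_bSet (t : Tm) :
    ∃ F : Finset Tm, F.card ≤ tsize t ^ 2 * 2 ^ tsize t ∧ BSet t ⊆ F := by
  classical
  choose Z hZcard hZ using exists_finset_zeta
  choose G hGcard hGself hG using exists_finset_guards
  obtain ⟨keys, hkcard, hkeys⟩ := exists_finset_keys t
  have hcount := symCount_add_le (p := (· == .sk)) (q := (· == .enc))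
    (fun f => by
      by_cases h : f = .sk
      · subst h; decide
      · rw [beq_false_of_ne h, Bool.toNat_false, Nat.zero_add]; exact Bool.toNat_le _) t
  refine ⟨keys.powerset.biUnion fun K => (subterms (fun _ => true) t).biUnion fun w =>
    ((Z K w).filter fun z => TSub t w ∧ tsize z ≤ tsize t).biUnion (G K), ?_, ?_⟩
  · have hzeta : ∀ K w, ((Z K w).filter fun z => TSub t w ∧ tsize z ≤ tsize t).card ≤
        2 ^ symCount (· == .enc) t := fun K w => by
      by_cases hw : TSub t w
      · exact (Finset.card_filter_le _ _).trans
          ((hZcard K w).trans (Nat.pow_le_pow_right two_pos (hw.symCount_le _)))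
      · simp [hw]
    calc
      _ ≤ 2 ^ keys.card * (tsize t * (2 ^ symCount (· == .enc) t * tsize t)) := by
        rw [← Finset.card_powerset]
        refine Finset.card_biUnion_le_card_mul _ _ _ fun K _ => ?_
        refine (Finset.card_biUnion_le_card_mul _ _ _ fun w _ => ?_).trans
          (Nat.mul_le_mul_right _ (card_subterms_true_le t))
        refine (Finset.card_biUnion_le_card_mul _ _ _ fun z hz => ?_).trans
          (Nat.mul_le_mul_right _ (hzeta K w))
        exact (hGcard K z).trans (Finset.mem_filter.1 hz).2.2
      _ = tsize t ^ 2 * 2 ^ (keys.card + symCount (· == .enc) t) := by ring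
      _ ≤ _ := Nat.mul_le_mul_left _ (Nat.pow_le_pow_right two_pos (by omega))
  · rintro u ⟨K, hK, w, hw, hu⟩
    have hw := tSub_of_leaf_or_cond hw
    obtain ⟨z, hz, hu⟩ : ∃ z, Zeta K w z ∧ u ∈ G K z := by
      rcases hu with hu | ⟨s, m, r, k, hk, hz, hs, rfl⟩
      · exact ⟨u, hu, hGself K u⟩
      · exact ⟨_, hz, hG K _ _ ⟨s, m, r, k, hk, rfl, hs, rfl⟩⟩
    simp only [Finset.coe_biUnion, Set.mem_iUnion, Finset.mem_coe, Finset.mem_powerset,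
      Finset.mem_filter, exists_prop]
    exact ⟨K, fun k hk => hkeys k (hK k hk), w, hw.mem_subterms_true, z,
      ⟨hZ K w z hz, hw, hz.tsize_le.trans hw.tsize_le⟩, hu⟩

/-- size bound on B(t).  For every ground term t, every
u ∈ B(t) satisfies |u| ≤ 2·|t↓_R|, and B(t) has at most |t↓_R|² · 2^{|t↓_R|}
elements. -/
theorem stmt16
    (prec : FSym → FSym → Prop) (hprec : PrecOK prec)
    (su : Tm → Tm → Prop) (hsu : SuOK su)
    (t tn : Tm) (htn : IsNfOf prec su t tn) :
    (∀ u ∈ BSet tn, tsize u ≤ 2 * tsize tn) ∧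
    (BSet tn).Finite ∧
    (BSet tn).ncard ≤ tsize tn ^ 2 * 2 ^ tsize tn := by
  refine ⟨?_, ?_⟩
  · rintro u ⟨K, -, w, hw, hu⟩
    have hle := (tSub_of_leaf_or_cond hw).tsize_le
    rcases hu with hu | hu
    · have := hu.tsize_le
      omega
    · have := tsize_le_of_mem_guardsK hu
      omega
  · obtain ⟨F, hF, hsub⟩ := exists_finset_bSet tn
    refine ⟨F.finite_toSet.subset hsub, le_trans ?_ hF⟩
    simpa using Set.ncard_le_ncard hsub F.finite_toSet
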